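/- Let k ∈ ℕ and let (V, C, e) be a k-AOU space. Let (I, κ) be an injective envelope of the operator system V_{k-min} in the category of operator systems. Then, regarding I as a k-AOU space via its level-k cone, the pair (I, κ) is an injective envelope of (V, C, e) in the category of k-AOU spaces; moreover, any injective envelope of (V, C, e) in the category of k-AOU spaces is unitally k-order isomorphic to I. -/

import Mathlib

open scoped ComplexConjugate ComplexOrder

noncomputable section

universe u v

/-- The diagonal matrix `I_n ⊗ e` in `M_n(V)`. -/
def unitMat {V : Type u} [AddCommGroup V] (n : ℕ) (e : V) : Matrix (Fin n) (Fin n) V :=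
  Matrix.of fun i j => if i = j then e else 0

/-- The conjugation `α* x α ∈ M_m(V)` of `x ∈ M_n(V)` by a scalar matrix `α ∈ M_{n,m}(ℂ)`. -/
def conjAct {V : Type u} [AddCommGroup V] [Module ℂ V] {n m : ℕ}
    (α : Matrix (Fin n) (Fin m) ℂ) (x : Matrix (Fin n) (Fin n) V) :
    Matrix (Fin m) (Fin m) V :=
  Matrix.of fun i j => ∑ p : Fin n, ∑ q : Fin n, (conj (α p i) * α q j) • x p q

section Defs

variable {V : Type u} [AddCommGroup V] [Module ℂ V] [StarAddMonoid V] [StarModule ℂ V]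

/-- `(V, C, e)` is a `k`-AOU space. -/
structure IsKAOU (k : ℕ) (C : Set (Matrix (Fin k) (Fin k) V)) (e : V) : Prop where
  herm : ∀ x ∈ C, star x = x
  add_mem : ∀ x ∈ C, ∀ y ∈ C, x + y ∈ C
  smul_mem : ∀ r : ℝ, 0 ≤ r → ∀ x ∈ C, (r : ℂ) • x ∈ C
  proper : ∀ x ∈ C, -x ∈ C → x = 0
  compat : ∀ α : Matrix (Fin k) (Fin k) ℂ, ∀ x ∈ C, conjAct α x ∈ C
  orderUnit : ∀ x : Matrix (Fin k) (Fin k) V, star x = x →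
    ∃ r : ℝ, 0 < r ∧ (r : ℂ) • unitMat k e - x ∈ C
  arch : ∀ x : Matrix (Fin k) (Fin k) V,
    (∀ r : ℝ, 0 < r → x + (r : ℂ) • unitMat k e ∈ C) → x ∈ C

/-- A matrix ordering on the `*`-vector space `V`. -/
structure IsMatrixOrdering (C : ∀ n : ℕ, Set (Matrix (Fin n) (Fin n) V)) : Prop where
  herm : ∀ n, ∀ x ∈ C n, star x = x
  add_mem : ∀ n, ∀ x ∈ C n, ∀ y ∈ C n, x + y ∈ C n
  smul_mem : ∀ n, ∀ r : ℝ, 0 ≤ r → ∀ x ∈ C n, (r : ℂ) • x ∈ C n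
  proper : ∀ n, ∀ x ∈ C n, -x ∈ C n → x = 0
  compat : ∀ n m : ℕ, ∀ α : Matrix (Fin n) (Fin m) ℂ, ∀ x ∈ C n, conjAct α x ∈ C m

/-- `(V, {C_n}, e)` is an (abstract) operator system. -/
structure IsOperatorSystem (C : ∀ n : ℕ, Set (Matrix (Fin n) (Fin n) V)) (e : V)
    extends IsMatrixOrdering C : Prop where
  orderUnit : ∀ n : ℕ, ∀ x : Matrix (Fin n) (Fin n) V, star x = x →
    ∃ r : ℝ, 0 < r ∧ (r : ℂ) • unitMat n e - x ∈ C n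
  arch : ∀ n : ℕ, ∀ x : Matrix (Fin n) (Fin n) V,
    (∀ r : ℝ, 0 < r → x + (r : ℂ) • unitMat n e ∈ C n) → x ∈ C n

/-- The cones `C_n^{k-min}` associated to a `k`-AOU space `(V, C, e)`. -/
def kMinCone (k : ℕ) (C : Set (Matrix (Fin k) (Fin k) V)) (n : ℕ) :
    Set (Matrix (Fin n) (Fin n) V) :=
  {x | star x = x ∧ ∀ α : Matrix (Fin n) (Fin k) ℂ, conjAct α x ∈ C}

/-- `{𝒞_n}` is an extension of the `k`-AOU space `(V, C, e)`: a matrix ordering with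
`𝒞_k = C` making `(V, {𝒞_n}, e)` an operator system. -/
def IsExtension (k : ℕ) (C : Set (Matrix (Fin k) (Fin k) V)) (e : V)
    (𝒞 : ∀ n : ℕ, Set (Matrix (Fin n) (Fin n) V)) : Prop :=
  IsOperatorSystem 𝒞 e ∧ 𝒞 k = C

end Defs

/-- Bundled data of a `k`-AOU space: a `*`-vector space with a distinguished subset of
`M_k(carrier)` and a distinguished element. -/
structure KAOUData (k : ℕ) : Type (u + 1) where
  carrier : Type u
  [addCommGroup : AddCommGroup carrier]
  [module : Module ℂ carrier]
  [starAddMonoid : StarAddMonoid carrier]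
  [starModule : StarModule ℂ carrier]
  cone : Set (Matrix (Fin k) (Fin k) carrier)
  unit : carrier

attribute [instance] KAOUData.addCommGroup KAOUData.module KAOUData.starAddMonoid
  KAOUData.starModule

/-- The bundled data is a `k`-AOU space. -/
def KAOUData.IsK {k : ℕ} (A : KAOUData.{u} k) : Prop := IsKAOU k A.cone A.unit

/-- `φ` is a unital `k`-positive map between (the data of) `k`-AOU spaces. -/
def UKPos {k : ℕ} (A : KAOUData.{u} k) (B : KAOUData.{v} k)
    (φ : A.carrier →ₗ[ℂ] B.carrier) : Prop :=
  φ A.unit = B.unit ∧ ∀ x ∈ A.cone, x.map ⇑φ ∈ B.cone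

/-- `φ` is a unital `k`-order embedding between (the data of) `k`-AOU spaces. -/
def UKOrderEmb {k : ℕ} (A : KAOUData.{u} k) (B : KAOUData.{v} k)
    (φ : A.carrier →ₗ[ℂ] B.carrier) : Prop :=
  UKPos A B φ ∧ Function.Injective φ ∧
    ∀ x : Matrix (Fin k) (Fin k) A.carrier, x.map ⇑φ ∈ B.cone → x ∈ A.cone

/-- Bundled data of an operator system: a `*`-vector space with a family of distinguished
matricial subsets and a distinguished element. -/
structure OSData : Type (u + 1) where
  carrier : Type u
  [addCommGroup : AddCommGroup carrier]
  [module : Module ℂ carrier]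
  [starAddMonoid : StarAddMonoid carrier]
  [starModule : StarModule ℂ carrier]
  cones : ∀ n : ℕ, Set (Matrix (Fin n) (Fin n) carrier)
  unit : carrier

attribute [instance] OSData.addCommGroup OSData.module OSData.starAddMonoid OSData.starModule

/-- The bundled data is an operator system. -/
def OSData.IsOS (A : OSData.{u}) : Prop := IsOperatorSystem A.cones A.unit

/-- `φ` is a unital completely positive map between (the data of) operator systems. -/
def UCP (A : OSData.{u}) (B : OSData.{v}) (φ : A.carrier →ₗ[ℂ] B.carrier) : Prop :=
  φ A.unit = B.unit ∧ ∀ n : ℕ, ∀ x ∈ A.cones n, x.map ⇑φ ∈ B.cones n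

/-- `φ` is a unital complete order embedding between (the data of) operator systems. -/
def UCOrderEmb (A : OSData.{u}) (B : OSData.{v}) (φ : A.carrier →ₗ[ℂ] B.carrier) : Prop :=
  UCP A B φ ∧ Function.Injective φ ∧
    ∀ (n : ℕ) (x : Matrix (Fin n) (Fin n) A.carrier), x.map ⇑φ ∈ B.cones n → x ∈ A.cones n

/-- `A` is `k`-minimal as an operator system. -/
def OSData.kMinimal (A : OSData.{u}) (k : ℕ) : Prop :=
  ∀ n : ℕ, A.cones n = kMinCone k (A.cones k) n

/-- `T` is an injective operator system. -/
def OSInjective (T : OSData.{u}) : Prop :=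
  ∀ A B : OSData.{u}, A.IsOS → B.IsOS →
    ∀ ι : A.carrier →ₗ[ℂ] B.carrier, UCOrderEmb A B ι →
      ∀ φ : A.carrier →ₗ[ℂ] T.carrier, UCP A T φ →
        ∃ ψ : B.carrier →ₗ[ℂ] T.carrier, UCP B T ψ ∧ ψ.comp ι = φ

/-- `(T, κ)` is an essential extension of the operator system `Vd`: every unital completely
positive map out of `T` restricting to a unital complete order embedding on (the image of)
`Vd` is itself a unital complete order embedding. -/
def OSEssential (Vd T : OSData.{u}) (κ : Vd.carrier →ₗ[ℂ] T.carrier) : Prop :=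
  ∀ W : OSData.{u}, W.IsOS →
    ∀ φ : T.carrier →ₗ[ℂ] W.carrier, UCP T W φ →
      UCOrderEmb Vd W (φ.comp κ) → UCOrderEmb T W φ

/-- `(T, κ)` is an injective envelope of the operator system `Vd`. -/
def IsInjEnvelopeOS (Vd T : OSData.{u}) (κ : Vd.carrier →ₗ[ℂ] T.carrier) : Prop :=
  T.IsOS ∧ OSInjective T ∧ UCOrderEmb Vd T κ ∧ OSEssential Vd T κ

/-- `T` is an injective `k`-AOU space. -/
def KInjective {k : ℕ} (T : KAOUData.{u} k) : Prop :=
  ∀ A B : KAOUData.{u} k, A.IsK → B.IsK →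
    ∀ ι : A.carrier →ₗ[ℂ] B.carrier, UKOrderEmb A B ι →
      ∀ φ : A.carrier →ₗ[ℂ] T.carrier, UKPos A T φ →
        ∃ ψ : B.carrier →ₗ[ℂ] T.carrier, UKPos B T ψ ∧ ψ.comp ι = φ

/-- `(T, κ)` is an essential extension of the `k`-AOU space `Vd`. -/
def KEssential {k : ℕ} (Vd T : KAOUData.{u} k) (κ : Vd.carrier →ₗ[ℂ] T.carrier) : Prop :=
  ∀ W : KAOUData.{u} k, W.IsK →
    ∀ φ : T.carrier →ₗ[ℂ] W.carrier, UKPos T W φ →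
      UKOrderEmb Vd W (φ.comp κ) → UKOrderEmb T W φ

/-- `(T, κ)` is an injective envelope of the `k`-AOU space `Vd`. -/
def IsInjEnvelopeK {k : ℕ} (Vd T : KAOUData.{u} k) (κ : Vd.carrier →ₗ[ℂ] T.carrier) : Prop :=
  T.IsK ∧ KInjective T ∧ UKOrderEmb Vd T κ ∧ KEssential Vd T κ

/-- The operator system `V_{k-min}` (as data) associated to a `k`-AOU space. -/
def KAOUData.kminOS {k : ℕ} (A : KAOUData.{u} k) : OSData.{u} where
  carrier := A.carrier
  cones := kMinCone k A.cone
  unit := A.unit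

/-- The `k`-AOU space (as data) obtained from an operator system by keeping the level-`k`
cone. -/
def OSData.levelK (T : OSData.{u}) (k : ℕ) : KAOUData.{u} k where
  carrier := T.carrier
  cone := T.cones k
  unit := T.unit

section ConjAct

variable {V : Type u} [AddCommGroup V] [Module ℂ V]

/-- The elementary tensor `P ⊗ v ∈ M_n(V)` of a scalar matrix and a vector. -/
def matTensor {n : ℕ} (P : Matrix (Fin n) (Fin n) ℂ) (v : V) : Matrix (Fin n) (Fin n) V :=
  P.map (· • v)

theorem unitMat_eq_matTensor (n : ℕ) (v : V) : unitMat n v = matTensor 1 v := by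
  ext i j
  by_cases h : i = j <;> simp [unitMat, matTensor, h]

theorem conjAct_add {n m : ℕ} (α : Matrix (Fin n) (Fin m) ℂ) (x y : Matrix (Fin n) (Fin n) V) :
    conjAct α (x + y) = conjAct α x + conjAct α y := by
  ext i j
  simp [conjAct, smul_add, Finset.sum_add_distrib]

theorem conjAct_smul {n m : ℕ} (α : Matrix (Fin n) (Fin m) ℂ) (c : ℂ)
    (x : Matrix (Fin n) (Fin n) V) : conjAct α (c • x) = c • conjAct α x := by
  ext i j
  simp [conjAct, Finset.smul_sum, smul_comm c]

theorem conjAct_neg {n m : ℕ} (α : Matrix (Fin n) (Fin m) ℂ) (x : Matrix (Fin n) (Fin n) V) :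
    conjAct α (-x) = -conjAct α x := by
  ext i j
  simp [conjAct]

theorem conjAct_sub {n m : ℕ} (α : Matrix (Fin n) (Fin m) ℂ) (x y : Matrix (Fin n) (Fin n) V) :
    conjAct α (x - y) = conjAct α x - conjAct α y := by
  rw [sub_eq_add_neg, conjAct_add, conjAct_neg, ← sub_eq_add_neg]

theorem conjAct_one {n : ℕ} (x : Matrix (Fin n) (Fin n) V) : conjAct 1 x = x := by
  ext i j
  simp [conjAct, Matrix.one_apply, apply_ite, ite_smul]

theorem conjAct_conjAct {n m l : ℕ} (α : Matrix (Fin n) (Fin m) ℂ) (β : Matrix (Fin m) (Fin l) ℂ)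
    (x : Matrix (Fin n) (Fin n) V) : conjAct β (conjAct α x) = conjAct (α * β) x := by
  ext i j
  simp only [conjAct, Matrix.of_apply, Matrix.mul_apply, map_sum, map_mul, Finset.smul_sum,
    Finset.sum_mul_sum, Finset.sum_smul, smul_smul]
  have key : ∀ f : Fin m → Fin m → Fin n → Fin n → V,
      ∑ a, ∑ b, ∑ p, ∑ q, f a b p q = ∑ p, ∑ q, ∑ a, ∑ b, f a b p q := by
    intro f
    calc _ = ∑ a, ∑ p, ∑ b, ∑ q, f a b p q :=
          Finset.sum_congr rfl fun a _ => Finset.sum_comm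
      _ = ∑ p, ∑ a, ∑ b, ∑ q, f a b p q := Finset.sum_comm
      _ = ∑ p, ∑ a, ∑ q, ∑ b, f a b p q :=
          Finset.sum_congr rfl fun p _ => Finset.sum_congr rfl fun a _ => Finset.sum_comm
      _ = _ := Finset.sum_congr rfl fun p _ => Finset.sum_comm
  rw [key]
  refine Finset.sum_congr rfl fun p _ => Finset.sum_congr rfl fun q _ =>
    Finset.sum_congr rfl fun a _ => Finset.sum_congr rfl fun b _ => ?_
  congr 1
  ring

theorem conjAct_matTensor {n m : ℕ} (α : Matrix (Fin n) (Fin m) ℂ) (P : Matrix (Fin n) (Fin n) ℂ)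
    (v : V) : conjAct α (matTensor P v) = matTensor (α.conjTranspose * P * α) v := by
  ext i j
  simp only [conjAct, matTensor, Matrix.of_apply, Matrix.map_apply, Matrix.mul_apply,
    Matrix.conjTranspose_apply, Finset.sum_mul, Finset.sum_smul, smul_smul]
  rw [Finset.sum_comm]
  refine Finset.sum_congr rfl fun q _ => Finset.sum_congr rfl fun p _ => ?_
  congr 1
  simp only [starRingEnd_apply]
  ring

theorem map_conjAct {W : Type v} [AddCommGroup W] [Module ℂ W] {n m : ℕ}
    (α : Matrix (Fin n) (Fin m) ℂ) (φ : V →ₗ[ℂ] W) (x : Matrix (Fin n) (Fin n) V) :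
    (conjAct α x).map φ = conjAct α (x.map φ) := by
  ext i j
  simp [conjAct]

theorem eq_zero_of_conjAct_eq_zero {n k : ℕ} (hk : 0 < k) {x : Matrix (Fin n) (Fin n) V}
    (h : ∀ α : Matrix (Fin n) (Fin k) ℂ, conjAct α x = 0) : x = 0 := by
  have hc : ∀ c : Fin n → ℂ, ∑ p, ∑ q, (conj (c p) * c q) • x p q = 0 := by
    intro c
    have := congrFun (congrFun (h (Matrix.of fun p _ => c p)) ⟨0, hk⟩) ⟨0, hk⟩
    simpa [conjAct] using this
  ext i j
  have hω : ∀ ω : ℂ, x i i + ω • x i j + conj ω • x j i + (conj ω * ω) • x j j = 0 := by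
    intro ω
    have hsum : ∀ (a : Fin n) (c : ℂ) (f : Fin n → V),
        ∑ p, (Pi.single a c : Fin n → ℂ) p • f p = c • f a := by
      intro a c f
      simp [Pi.single_apply, ite_smul]
    have hconj : ∀ (a : Fin n) (c : ℂ) (p : Fin n),
        conj ((Pi.single a c : Fin n → ℂ) p) = (Pi.single a (conj c) : Fin n → ℂ) p := by
      intro a c p
      by_cases h : p = a <;> simp [h]
    have := hc (Pi.single i 1 + Pi.single j ω)
    simp only [Pi.add_apply, map_add, hconj, mul_smul, ← Finset.smul_sum, add_smul,
      Finset.sum_add_distrib, hsum, smul_add, map_one, one_smul] at this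
    rw [← this]
    module
  have h1 := hω 1
  have h2 := hω (-1)
  have h3 := hω Complex.I
  have h4 := hω (-Complex.I)
  have : (4 : ℂ) • x i j = 0 := by
    have hI : Complex.I ^ 2 = -1 := Complex.I_sq
    simp only [map_neg, map_one, Complex.conj_I] at h1 h2 h3 h4
    linear_combination (norm := skip) h1 - h2 - Complex.I • h3 + Complex.I • h4
    match_scalars <;> ring_nf <;> simp [hI]
  simpa using this

variable [StarAddMonoid V] [StarModule ℂ V]

theorem star_conjAct {n m : ℕ} (α : Matrix (Fin n) (Fin m) ℂ) (x : Matrix (Fin n) (Fin n) V) :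
    star (conjAct α x) = conjAct α (star x) := by
  ext i j
  simp only [conjAct, Matrix.star_apply, Matrix.of_apply, star_sum, star_smul, star_mul']
  rw [Finset.sum_comm]
  refine Finset.sum_congr rfl fun p _ => Finset.sum_congr rfl fun q _ => ?_
  simp [mul_comm]

theorem star_eq_of_conjAct {n k : ℕ} (hk : 0 < k) {x : Matrix (Fin n) (Fin n) V}
    (h : ∀ α : Matrix (Fin n) (Fin k) ℂ, star (conjAct α x) = conjAct α x) : star x = x := by
  rw [← sub_eq_zero]
  refine eq_zero_of_conjAct_eq_zero hk fun α => ?_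
  rw [conjAct_sub, ← star_conjAct, h, sub_self]

end ConjAct

section Scalar

open scoped MatrixOrder Matrix.Norms.L2Operator

theorem Matrix.IsHermitian.exists_posSemidef_smul_one_sub {n : ℕ} {M : Matrix (Fin n) (Fin n) ℂ}
    (hM : M.IsHermitian) :
    ∃ c : ℝ, 0 < c ∧ ((c : ℂ) • (1 : Matrix (Fin n) (Fin n) ℂ) - M).PosSemidef := by
  have h := IsSelfAdjoint.le_algebraMap_norm_self (a := M) hM
  rw [Matrix.le_iff] at h
  refine ⟨‖M‖ + 1, by positivity, ?_⟩
  have h1 : (1 : Matrix (Fin n) (Fin n) ℂ).PosSemidef := Matrix.PosSemidef.one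
  have heq : ((‖M‖ + 1 : ℝ) : ℂ) • (1 : Matrix (Fin n) (Fin n) ℂ) - M =
      algebraMap ℝ (Matrix (Fin n) (Fin n) ℂ) ‖M‖ - M + 1 := by
    rw [Algebra.algebraMap_eq_smul_one]
    ext i j
    by_cases hij : i = j
    · simp [hij]
      ring
    · simp [hij]
  rw [heq]
  exact h.add h1

theorem Matrix.PosSemidef.exists_eq_conjTranspose_mul_self {n : ℕ} {P : Matrix (Fin n) (Fin n) ℂ}
    (hP : P.PosSemidef) : ∃ B : Matrix (Fin n) (Fin n) ℂ, P = B.conjTranspose * B :=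
  CStarAlgebra.nonneg_iff_eq_star_mul_self.mp hP.nonneg

end Scalar

theorem star_unitMat {V : Type u} [AddCommGroup V] [StarAddMonoid V] (n : ℕ) {v : V}
    (hv : star v = v) : star (unitMat n v) = unitMat n v := by
  ext i j
  by_cases h : i = j <;> simp [unitMat, Matrix.star_apply, h, hv, eq_comm]

section KMin

variable {V : Type u} [AddCommGroup V] [Module ℂ V] [StarAddMonoid V]
  {k : ℕ} {C : Set (Matrix (Fin k) (Fin k) V)} {e : V}

namespace IsKAOU

theorem kMinCone_self (hV : IsKAOU k C e) : kMinCone k C k = C := by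
  ext x
  exact ⟨fun h => conjAct_one x ▸ h.2 1, fun h => ⟨hV.herm x h, fun α => hV.compat α x h⟩⟩

theorem unitMat_mem (hV : IsKAOU k C e) : unitMat k e ∈ C := by
  obtain ⟨r, hr, h⟩ := hV.orderUnit 0 (star_zero _)
  have := hV.smul_mem r⁻¹ (inv_nonneg.mpr hr.le) _ h
  rwa [sub_zero, smul_smul, ← Complex.ofReal_mul, inv_mul_cancel₀ hr.ne', Complex.ofReal_one,
    one_smul] at this

theorem matTensor_mem (hV : IsKAOU k C e) {P : Matrix (Fin k) (Fin k) ℂ} (hP : P.PosSemidef)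
    {v : V} (hv : unitMat k v ∈ C) : matTensor P v ∈ C := by
  obtain ⟨B, rfl⟩ := hP.exists_eq_conjTranspose_mul_self
  have := hV.compat B _ hv
  rwa [unitMat_eq_matTensor, conjAct_matTensor, Matrix.mul_one] at this

end IsKAOU

variable [StarModule ℂ V]

theorem mem_kMinCone_iff (hk : 0 < k) (hC : ∀ x ∈ C, star x = x) {n : ℕ}
    {x : Matrix (Fin n) (Fin n) V} :
    x ∈ kMinCone k C n ↔ ∀ α : Matrix (Fin n) (Fin k) ℂ, conjAct α x ∈ C :=
  ⟨fun h => h.2, fun h => ⟨star_eq_of_conjAct hk fun α => hC _ (h α), h⟩⟩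

namespace IsKAOU

theorem matTensor_mem_kMinCone (hk : 0 < k) (hV : IsKAOU k C e) {n : ℕ}
    {P : Matrix (Fin n) (Fin n) ℂ} (hP : P.PosSemidef) {v : V} (hv : unitMat k v ∈ C) :
    matTensor P v ∈ kMinCone k C n := by
  rw [mem_kMinCone_iff hk hV.herm]
  intro α
  rw [conjAct_matTensor]
  exact hV.matTensor_mem (hP.conjTranspose_mul_mul_same α) hv

theorem unitMat_mem_kMinCone (hk : 0 < k) (hV : IsKAOU k C e) (n : ℕ) :
    unitMat n e ∈ kMinCone k C n := by
  rw [unitMat_eq_matTensor]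
  exact hV.matTensor_mem_kMinCone hk .one hV.unitMat_mem

theorem isMatrixOrdering_kMinCone (hk : 0 < k) (hV : IsKAOU k C e) :
    IsMatrixOrdering (kMinCone k C) where
  herm n x hx := hx.1
  add_mem n x hx y hy := by
    rw [mem_kMinCone_iff hk hV.herm]
    intro α
    rw [conjAct_add]
    exact hV.add_mem _ (hx.2 α) _ (hy.2 α)
  smul_mem n r hr x hx := by
    rw [mem_kMinCone_iff hk hV.herm]
    intro α
    rw [conjAct_smul]
    exact hV.smul_mem r hr _ (hx.2 α)
  proper n x hx hx' := by
    refine eq_zero_of_conjAct_eq_zero hk fun α => hV.proper _ (hx.2 α) ?_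
    rw [← conjAct_neg]
    exact hx'.2 α
  compat n m β x hx := by
    rw [mem_kMinCone_iff hk hV.herm]
    intro α
    rw [conjAct_conjAct]
    exact hx.2 _

/-- `x ∈ M_n(V)` is dominated by a multiple of the unit of `V_{k-min}`. -/
def BoundedAbove (k : ℕ) (C : Set (Matrix (Fin k) (Fin k) V)) (e : V) {n : ℕ}
    (x : Matrix (Fin n) (Fin n) V) : Prop :=
  ∃ r : ℝ, 0 < r ∧ (r : ℂ) • unitMat n e - x ∈ kMinCone k C n

theorem boundedAbove_add (hk : 0 < k) (hV : IsKAOU k C e) {n : ℕ}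
    {x y : Matrix (Fin n) (Fin n) V} (hx : BoundedAbove k C e x) (hy : BoundedAbove k C e y) :
    BoundedAbove k C e (x + y) := by
  obtain ⟨r, hr, h⟩ := hx
  obtain ⟨s, hs, h'⟩ := hy
  refine ⟨r + s, add_pos hr hs, ?_⟩
  convert (hV.isMatrixOrdering_kMinCone hk).add_mem n _ h _ h' using 1
  rw [Complex.ofReal_add, add_smul]
  abel

theorem boundedAbove_sum (hk : 0 < k) (hV : IsKAOU k C e) {n : ℕ} {ι : Type*} (s : Finset ι)
    {f : ι → Matrix (Fin n) (Fin n) V} (hf : ∀ i ∈ s, BoundedAbove k C e (f i)) :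
    BoundedAbove k C e (∑ i ∈ s, f i) := by
  refine Finset.sum_induction f (BoundedAbove k C e) (fun _ _ => hV.boundedAbove_add hk) ?_ hf
  exact ⟨1, one_pos, by simpa using hV.unitMat_mem_kMinCone hk n⟩

theorem boundedAbove_matTensor_of_posSemidef (hk : 0 < k) (hV : IsKAOU k C e) {n : ℕ}
    {P : Matrix (Fin n) (Fin n) ℂ} (hP : P.PosSemidef) {v : V} (hv : star v = v) :
    BoundedAbove k C e (matTensor P v) := by
  obtain ⟨s, hs, h⟩ := hV.orderUnit _ (star_unitMat k hv)
  have hsv : (s : ℂ) • unitMat k e - unitMat k v = unitMat k ((s : ℂ) • e - v) := by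
    ext i j
    by_cases hij : i = j <;> simp [unitMat, hij]
  rw [hsv] at h
  obtain ⟨c, hc, hcP⟩ := hP.isHermitian.exists_posSemidef_smul_one_sub
  refine ⟨s * c, mul_pos hs hc, ?_⟩
  have hord := hV.isMatrixOrdering_kMinCone hk
  convert hord.add_mem n _ (hord.smul_mem n s hs.le _
    (hV.matTensor_mem_kMinCone hk hcP hV.unitMat_mem)) _ (hV.matTensor_mem_kMinCone hk hP h) using 1
  rw [unitMat_eq_matTensor]
  ext i j
  simp only [matTensor, Matrix.add_apply, Matrix.sub_apply, Matrix.smul_apply, Matrix.map_apply,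
    Complex.ofReal_mul, smul_eq_mul]
  module

theorem boundedAbove_matTensor (hk : 0 < k) (hV : IsKAOU k C e) {n : ℕ}
    {M : Matrix (Fin n) (Fin n) ℂ} (hM : M.IsHermitian) {v : V} (hv : star v = v) :
    BoundedAbove k C e (matTensor M v) := by
  obtain ⟨c, hc, h⟩ := hM.neg.exists_posSemidef_smul_one_sub
  have h1 : ((c : ℂ) • (1 : Matrix (Fin n) (Fin n) ℂ)).PosSemidef :=
    Matrix.PosSemidef.one.smul (by exact_mod_cast hc.le)
  convert hV.boundedAbove_add hk (hV.boundedAbove_matTensor_of_posSemidef hk h hv)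
    (hV.boundedAbove_matTensor_of_posSemidef hk h1 (v := -v) (by rw [star_neg, hv])) using 1
  ext i j
  simp only [matTensor, Matrix.add_apply, Matrix.sub_apply, Matrix.smul_apply, Matrix.map_apply,
    Matrix.neg_apply, smul_eq_mul]
  module

theorem boundedAbove_single_add_single (hk : 0 < k) (hV : IsKAOU k C e) {n : ℕ} (i j : Fin n)
    (y : V) :
    BoundedAbove k C e
      ((1 / 2 : ℂ) • (Matrix.single i j y + Matrix.single j i (star y))) := by
  have hI : Complex.I ^ 2 = -1 := Complex.I_sq
  have hM : (Matrix.single i j (1 / 2 : ℂ) + Matrix.single j i (1 / 2 : ℂ)).IsHermitian := by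
    rw [Matrix.IsHermitian, Matrix.conjTranspose_add, Matrix.conjTranspose_single,
      Matrix.conjTranspose_single, add_comm]
    simp
  have hN : (Matrix.single i j (Complex.I / 2) + Matrix.single j i (-Complex.I / 2)).IsHermitian := by
    rw [Matrix.IsHermitian, Matrix.conjTranspose_add, Matrix.conjTranspose_single,
      Matrix.conjTranspose_single, add_comm]
    simp
  have ha : star ((1 / 2 : ℂ) • (y + star y)) = (1 / 2 : ℂ) • (y + star y) := by
    simp [star_smul, add_comm]
  have hb : star ((Complex.I / 2) • (star y - y)) = (Complex.I / 2) • (star y - y) := by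
    simp only [star_smul, star_sub, star_star, star_div₀, Complex.star_def, Complex.conj_I,
      Complex.conj_ofNat]
    module
  convert hV.boundedAbove_add hk (hV.boundedAbove_matTensor hk hM ha)
    (hV.boundedAbove_matTensor hk hN hb) using 1
  ext p q
  simp only [matTensor, Matrix.add_apply, Matrix.smul_apply, Matrix.map_apply, Matrix.single_apply]
  split_ifs <;> match_scalars <;> ring_nf <;> simp [hI] <;> norm_num

theorem boundedAbove_of_star_eq (hk : 0 < k) (hV : IsKAOU k C e) {n : ℕ}
    {x : Matrix (Fin n) (Fin n) V} (hx : star x = x) : BoundedAbove k C e x := by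
  have hsum : x = ∑ i, ∑ j,
      (1 / 2 : ℂ) • (Matrix.single i j (x i j) + Matrix.single j i (star (x i j))) := by
    have h2 : ∑ i, ∑ j, Matrix.single j i (star (x i j)) = x := by
      rw [Finset.sum_comm]
      conv_rhs => rw [← hx, Matrix.matrix_eq_sum_single (star x)]
      rfl
    simp only [← Finset.smul_sum, Finset.sum_add_distrib]
    rw [h2, ← Matrix.matrix_eq_sum_single]
    module
  rw [hsum]
  exact hV.boundedAbove_sum hk _ fun i _ => hV.boundedAbove_sum hk _ fun j _ =>
    hV.boundedAbove_single_add_single hk i j _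

theorem isOperatorSystem_kMinCone (hk : 0 < k) (hV : IsKAOU k C e) :
    IsOperatorSystem (kMinCone k C) e where
  toIsMatrixOrdering := hV.isMatrixOrdering_kMinCone hk
  orderUnit n x hx := hV.boundedAbove_of_star_eq hk hx
  arch n x hx := by
    rw [mem_kMinCone_iff hk hV.herm]
    intro α
    refine hV.arch _ fun r hr => ?_
    have hα : (α.conjTranspose * α).PosSemidef := Matrix.posSemidef_conjTranspose_mul_self α
    obtain ⟨c, hc, hcα⟩ := hα.isHermitian.exists_posSemidef_smul_one_sub
    have h := (hx (r / c) (div_pos hr hc)).2 α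
    rw [conjAct_add, conjAct_smul, unitMat_eq_matTensor, conjAct_matTensor, Matrix.mul_one] at h
    convert hV.add_mem _ h _ (hV.smul_mem (r / c) (div_pos hr hc).le _
      (hV.matTensor_mem hcα hV.unitMat_mem)) using 1
    have hrc : (r : ℂ) = (r / c : ℝ) * c := by
      rw [← Complex.ofReal_mul, div_mul_cancel₀ _ hc.ne']
    rw [unitMat_eq_matTensor]
    conv_lhs => rw [hrc]
    ext i j
    simp only [matTensor, Matrix.add_apply, Matrix.sub_apply, Matrix.smul_apply, Matrix.map_apply,
      smul_eq_mul]
    module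

end IsKAOU

end KMin

theorem OSData.IsOS.isK_levelK {T : OSData.{u}} (hT : T.IsOS) (k : ℕ) : (T.levelK k).IsK where
  herm := hT.herm k
  add_mem := hT.add_mem k
  smul_mem := hT.smul_mem k
  proper := hT.proper k
  compat := hT.compat k k
  orderUnit := hT.orderUnit k
  arch := hT.arch k

section Functoriality

variable {k : ℕ} {A : KAOUData.{u} k} {B : KAOUData.{v} k} {φ : A.carrier →ₗ[ℂ] B.carrier}

theorem KAOUData.IsK.isOS_kminOS (hk : 0 < k) (hA : A.IsK) : A.kminOS.IsOS :=
  IsKAOU.isOperatorSystem_kMinCone hk hA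

theorem UKPos.ucp_kminOS (hk : 0 < k) (hB : B.IsK) (h : UKPos A B φ) :
    UCP A.kminOS B.kminOS φ := by
  refine ⟨h.1, fun n (x : Matrix (Fin n) (Fin n) A.carrier) hx =>
    (mem_kMinCone_iff hk hB.herm).mpr fun α => ?_⟩
  have := h.2 _ (hx.2 α)
  rwa [map_conjAct] at this

theorem UKOrderEmb.ucOrderEmb_kminOS (hk : 0 < k) (hA : A.IsK) (hB : B.IsK)
    (h : UKOrderEmb A B φ) : UCOrderEmb A.kminOS B.kminOS φ := by
  refine ⟨h.1.ucp_kminOS hk hB, h.2.1, fun n (x : Matrix (Fin n) (Fin n) A.carrier) hx =>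
    (mem_kMinCone_iff hk hA.herm).mpr fun α => h.2.2 _ ?_⟩
  rw [map_conjAct]
  exact hx.2 α

theorem UCOrderEmb.ukOrderEmb_levelK {T : OSData.{v}} {ψ : A.carrier →ₗ[ℂ] T.carrier}
    (hA : A.IsK) (h : UCOrderEmb A.kminOS T ψ) : UKOrderEmb A (T.levelK k) ψ :=
  ⟨⟨h.1.1, fun x hx => h.1.2 k x ((IsKAOU.kMinCone_self hA).ge hx)⟩, h.2.1,
    fun x hx => (IsKAOU.kMinCone_self hA).le (h.2.2 k x hx)⟩

end Functoriality

/-- An injective envelope of `V_{k-min}` is itself `k`-minimal, as the identity of its underlying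
space is completely positive into its `k`-minimal modification. -/
theorem IsInjEnvelopeOS.kMinimal {k : ℕ} (hk : 0 < k) {Vd : KAOUData.{u} k} (hV : Vd.IsK)
    {T : OSData.{u}} {κ : Vd.carrier →ₗ[ℂ] T.carrier} (henv : IsInjEnvelopeOS Vd.kminOS T κ) :
    T.kMinimal k := by
  obtain ⟨hT, -, hκ, hess⟩ := henv
  have hTk := hT.isK_levelK k
  have hκ' := hκ.ukOrderEmb_levelK hV
  have hle : ∀ n, T.cones n ⊆ kMinCone k (T.cones k) n := fun n x hx =>
    ⟨hT.herm n x hx, fun α => hT.compat n k α x hx⟩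
  have hid := hess _ (hTk.isOS_kminOS hk) LinearMap.id
    ⟨rfl, fun n x hx => hle n hx⟩ (hκ'.ucOrderEmb_kminOS hk hV hTk)
  exact fun n => (hle n).antisymm fun x hx => hid.2.2 n x hx

theorem OSInjective.kInjective_levelK {k : ℕ} (hk : 0 < k) {T : OSData.{u}} (hT : T.IsOS)
    (hinj : OSInjective T) (hmin : T.kMinimal k) : KInjective (T.levelK k) := by
  intro A B hA hB ι hι φ hφ
  have hφ' : UCP A.kminOS T φ := by
    refine ⟨hφ.1, fun n => ?_⟩
    rw [hmin n]
    exact (hφ.ucp_kminOS hk (hT.isK_levelK k)).2 n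
  obtain ⟨ψ, hψ, hψι⟩ := hinj _ _ (hA.isOS_kminOS hk) (hB.isOS_kminOS hk) ι
    (hι.ucOrderEmb_kminOS hk hA hB) φ hφ'
  refine ⟨ψ, ⟨hψ.1, fun x hx => hψ.2 k x ?_⟩, hψι⟩
  rw [← IsKAOU.kMinCone_self hB] at hx
  exact hx

theorem OSEssential.kEssential_levelK {k : ℕ} (hk : 0 < k) {Vd : KAOUData.{u} k} (hV : Vd.IsK)
    {T : OSData.{u}} (hmin : T.kMinimal k) {κ : Vd.carrier →ₗ[ℂ] T.carrier}
    (hess : OSEssential Vd.kminOS T κ) : KEssential Vd (T.levelK k) κ := by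
  intro W hW φ hφ hφκ
  have hφ' : UCP T W.kminOS φ := by
    refine ⟨hφ.1, fun n => ?_⟩
    rw [hmin n]
    exact (hφ.ucp_kminOS hk hW).2 n
  have h := hess _ (hW.isOS_kminOS hk) φ hφ' (hφκ.ucOrderEmb_kminOS hk hV hW)
  refine ⟨hφ, h.2.1, fun x hx => h.2.2 k x ?_⟩
  rw [← IsKAOU.kMinCone_self hW] at hx
  exact hx

theorem IsInjEnvelopeOS.isInjEnvelopeK_levelK {k : ℕ} (hk : 0 < k) {Vd : KAOUData.{u} k}
    (hV : Vd.IsK) {T : OSData.{u}} {κ : Vd.carrier →ₗ[ℂ] T.carrier}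
    (henv : IsInjEnvelopeOS Vd.kminOS T κ) : IsInjEnvelopeK Vd (T.levelK k) κ := by
  have hmin := henv.kMinimal hk hV
  obtain ⟨hT, hinj, hκ, hess⟩ := henv
  have hκ' := hκ.ukOrderEmb_levelK hV
  exact ⟨hT.isK_levelK k, hinj.kInjective_levelK hk hT hmin, hκ', hess.kEssential_levelK hk hV hmin⟩

/-- Any two injective envelopes of a `k`-AOU space are unitally `k`-order isomorphic. -/
theorem IsInjEnvelopeK.exists_bijective_ukOrderEmb {k : ℕ} {Vd J S : KAOUData.{u} k}
    (hV : Vd.IsK) {κ' : Vd.carrier →ₗ[ℂ] J.carrier} {κ : Vd.carrier →ₗ[ℂ] S.carrier}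
    (hJ : IsInjEnvelopeK Vd J κ') (hS : IsInjEnvelopeK Vd S κ) :
    ∃ θ : J.carrier →ₗ[ℂ] S.carrier, Function.Bijective θ ∧ UKOrderEmb J S θ := by
  obtain ⟨hJK, hJinj, hκ', hJess⟩ := hJ
  obtain ⟨hSK, hSinj, hκ, hSess⟩ := hS
  obtain ⟨ψ, hψ, hψκ⟩ := hJinj Vd S hV hSK κ hκ κ' hκ'.1
  have hψemb : UKOrderEmb S J ψ := hSess J hJK ψ hψ (hψκ ▸ hκ')
  obtain ⟨θ, hθ, hθψ⟩ := hSinj S J hSK hJK ψ hψemb LinearMap.id ⟨rfl, fun x hx => hx⟩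
  have hθκ : θ.comp κ' = κ := by
    rw [← hψκ, ← LinearMap.comp_assoc, hθψ, LinearMap.id_comp]
  have hθemb : UKOrderEmb J S θ := hJess S hSK θ hθ (hθκ ▸ hκ)
  exact ⟨θ, ⟨hθemb.2.1, fun y => ⟨ψ y, LinearMap.congr_fun hθψ y⟩⟩, hθemb⟩

/-- If `(T, κ)` is an injective envelope of the operator system `V_{k-min}`
associated to a `k`-AOU space `V`, then, regarding `T` as a `k`-AOU space via its level-`k`
cone, `(T, κ)` is an injective envelope of `V` in the category of `k`-AOU spaces; moreover,
any injective envelope of `V` in the category of `k`-AOU spaces is unitally `k`-order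
isomorphic to `T`. -/
theorem stmt_13 (k : ℕ) (hk : 0 < k) (Vd : KAOUData.{u} k) (hV : Vd.IsK)
    (T : OSData.{u}) (κ : Vd.carrier →ₗ[ℂ] T.carrier)
    (henv : IsInjEnvelopeOS Vd.kminOS T κ) :
    IsInjEnvelopeK Vd (T.levelK k) κ ∧
      ∀ (J : KAOUData.{u} k) (κ' : Vd.carrier →ₗ[ℂ] J.carrier),
        IsInjEnvelopeK Vd J κ' →
          ∃ θ : J.carrier →ₗ[ℂ] (T.levelK k).carrier,
            Function.Bijective θ ∧ UKOrderEmb J (T.levelK k) θ :=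
  ⟨henv.isInjEnvelopeK_levelK hk hV, fun _ _ hJ =>
    hJ.exists_bijective_ukOrderEmb hV (henv.isInjEnvelopeK_levelK hk hV)⟩
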